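/- For every natural number n, there is no family S_1, …, S_{n+1} of pairwise distinct nonempty subsets of [n] such that all pairwise intersections have the same cardinality, i.e. such that #(S_{i_1} ∩ S_{i_2}) = #(S_{i_1'} ∩ S_{i_2'}) for all pairs i_1 < i_2 and i_1' < i_2' in {1, …, n+1}. (Fisher's inequality, i.e. the validity of the principle FIE_n.) -/

import Mathlib

/-- If distinct nonempty finite sets have pairwise intersections of the same size `l`, then their
indicator vectors are linearly independent over `ℝ`. -/
theorem linearIndependent_indicator_of_card_inter_eq {ι α : Type*} [Fintype ι] [Nontrivial ι]
    [Fintype α] [DecidableEq α] {S : ι → Finset α} (hne : ∀ i, (S i).Nonempty)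
    (hinj : Function.Injective S) {l : ℕ} (hl : ∀ i j, i ≠ j → (S i ∩ S j).card = l) :
    LinearIndependent ℝ (fun i a => if a ∈ S i then (1 : ℝ) else 0) := by
  classical
  have hle : ∀ i, l ≤ (S i).card := fun i => by
    obtain ⟨j, hj⟩ := exists_ne i
    exact hl i j hj.symm ▸ Finset.card_le_card Finset.inter_subset_left
  rw [Fintype.linearIndependent_iff]
  intro c hc
  have gram : ∀ j, c j * ((S j).card - l) + l * ∑ i, c i = 0 := fun j => by
    have hsum : ∑ i, c i * ((S i ∩ S j).card : ℝ) = 0 := by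
      have h : ∀ i, c i * ((S i ∩ S j).card : ℝ)
          = ∑ a ∈ S j, c i * (if a ∈ S i then (1 : ℝ) else 0) := fun i => by
        rw [← Finset.mul_sum, Finset.sum_boole, Finset.filter_mem_eq_inter, Finset.inter_comm]
      simp_rw [h]
      rw [Finset.sum_comm]
      refine Finset.sum_eq_zero fun a _ => ?_
      simpa using congrFun hc a
    have hcard : ∀ i, ((S i ∩ S j).card : ℝ) = l + if i = j then ((S j).card : ℝ) - l else 0 := by
      intro i
      split_ifs with h
      · simp [h]
      · simp [hl i j h]
    simp only [hcard, mul_add, Finset.sum_add_distrib, mul_ite, mul_zero, Finset.sum_ite_eq',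
      Finset.mem_univ, if_true, ← Finset.sum_mul] at hsum
    linarith
  have hnonneg : ∀ j, 0 ≤ c j ^ 2 * ((S j).card - l : ℝ) := fun j =>
    mul_nonneg (sq_nonneg _) (sub_nonneg.2 (by exact_mod_cast hle j))
  have hquad : ∑ j, c j ^ 2 * ((S j).card - l : ℝ) + l * (∑ i, c i) ^ 2 = 0 := by
    have h : ∑ j, c j * (c j * ((S j).card - l) + l * ∑ i, c i) = 0 := by simp [gram]
    rw [← h]
    simp only [mul_add, Finset.sum_add_distrib, ← Finset.sum_mul]
    congr 1
    · exact Finset.sum_congr rfl fun _ _ => by ring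
    · ring
  have hsq : 0 ≤ (l : ℝ) * (∑ i, c i) ^ 2 := by positivity
  have hdiag : ∀ j, c j ≠ 0 → (S j).card = l := fun j hj => by
    have h0 : ∑ j, c j ^ 2 * ((S j).card - l : ℝ) = 0 :=
      le_antisymm (by linarith) (Finset.sum_nonneg fun j _ => hnonneg j)
    have h1 := (Finset.sum_eq_zero_iff_of_nonneg fun j _ => hnonneg j).1 h0 j (Finset.mem_univ j)
    have h2 := (mul_eq_zero.1 h1).resolve_left (pow_ne_zero 2 hj)
    exact_mod_cast sub_eq_zero.1 h2
  intro i
  by_contra hi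
  have hil := hdiag i hi
  have hothers : ∀ j, j ≠ i → c j = 0 := fun j hji => by
    by_contra hj
    have h1 : S j ∩ S i = S j :=
      Finset.eq_of_subset_of_card_le Finset.inter_subset_left (by rw [hl j i hji, hdiag j hj])
    have h2 : S j ∩ S i = S i :=
      Finset.eq_of_subset_of_card_le Finset.inter_subset_right (by rw [hl j i hji, hil])
    exact hji (hinj (h1.symm.trans h2))
  have hg := gram i
  rw [Fintype.sum_eq_single i hothers, hil, sub_self, mul_zero, zero_add] at hg
  have hl0 : (l : ℝ) = 0 := (mul_eq_zero.1 hg).resolve_right hi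
  exact (hne i).card_pos.ne' (hil.trans (by exact_mod_cast hl0))

/-- **Fisher's inequality** (validity of the principle `FIE_n`): for every natural number `n`,
there is no family `S_1, …, S_{n+1}` of pairwise distinct nonempty subsets of `[n]` all of
whose pairwise intersections have the same cardinality. -/
theorem fisher_inequality (n : ℕ) :
    ¬ ∃ S : Fin (n + 1) → Finset (Fin n),
        (∀ i, (S i).Nonempty) ∧
        (∀ i i' : Fin (n + 1), i ≠ i' → S i ≠ S i') ∧
        (∀ i₁ i₂ i₁' i₂' : Fin (n + 1), i₁ < i₂ → i₁' < i₂' →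
          (S i₁ ∩ S i₂).card = (S i₁' ∩ S i₂').card) := by
  rintro ⟨S, hne, hdist, hcard⟩
  have : NeZero n := ⟨by
    rintro rfl
    exact (hne 0).choose.elim0⟩
  have : Nontrivial (Fin (n + 1)) := Fin.nontrivial_iff_two_le.2 (by have := NeZero.pos n; omega)
  have hinj : Function.Injective S := fun i j h => by
    by_contra hij
    exact hdist i j hij h
  have hl : ∀ i j, i ≠ j → (S i ∩ S j).card = (S 0 ∩ S (Fin.last n)).card := fun i j hij => by
    have h0 : (0 : Fin (n + 1)) < Fin.last n := Fin.lt_def.2 (by simpa using NeZero.pos n)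
    rcases lt_or_gt_of_ne hij with h | h
    · exact hcard i j _ _ h h0
    · rw [Finset.inter_comm]
      exact hcard j i _ _ h h0
  have hindep := linearIndependent_indicator_of_card_inter_eq hne hinj hl
  simpa using hindep.fintype_card_le_finrank
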